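/- Suppose η ≥ η₀ = max(n, (32/γ²)·log(256/γ²)), t ≥ 1, and F(w_s) > 1/(8η) for all s ≤ t. Then for every index i with x̃_i·w̃_t < 0, writing a_t^i = ⟨w_t, x_i⟩, one has a_{t+1}^i − a_t^i ≥ max( η‖x_i‖²/(2n·(exp(a_t^i) + 1)), (1/2)·η·γ²·G(w_t) ). -/

import Mathlib

open scoped InnerProductSpace BigOperators
open Finset

/-- Logistic loss `F(w) = (1/n) ∑ᵢ log(1 + exp(−⟨w, xᵢ⟩))`. -/
noncomputable def logisticLoss (n : ℕ) (x : Fin n → EuclideanSpace ℝ (Fin 2))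
    (w : EuclideanSpace ℝ (Fin 2)) : ℝ :=
  (n : ℝ)⁻¹ * ∑ i, Real.log (1 + Real.exp (-⟪w, x i⟫_ℝ))

/-- Gradient potential `G(w) = (1/n) ∑ᵢ 1/(exp(⟨w, xᵢ⟩) + 1)`. -/
noncomputable def gradPotential (n : ℕ) (x : Fin n → EuclideanSpace ℝ (Fin 2))
    (w : EuclideanSpace ℝ (Fin 2)) : ℝ :=
  (n : ℝ)⁻¹ * ∑ i, (Real.exp ⟪w, x i⟫_ℝ + 1)⁻¹

/-- Gradient descent iterates: `w₀ = 0`, `w_{t+1} = w_t − η ∇F(w_t)`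
(the gradient of the logistic loss is written in closed form). -/
noncomputable def gdIter (n : ℕ) (x : Fin n → EuclideanSpace ℝ (Fin 2)) (η : ℝ) :
    ℕ → EuclideanSpace ℝ (Fin 2)
  | 0 => 0
  | t + 1 => gdIter n x η t
      + (η / n) • ∑ i, (Real.exp ⟪gdIter n x η t, x i⟫_ℝ + 1)⁻¹ • x i

/-- `γ` is the maximum margin of the dataset `x`:
it is the greatest `m` such that some unit vector `w` satisfies `⟨w, xᵢ⟩ ≥ m` for all `i`. -/
def isMaxMargin (n : ℕ) (x : Fin n → EuclideanSpace ℝ (Fin 2)) (γ : ℝ) : Prop :=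
  IsGreatest {m : ℝ | ∃ w : EuclideanSpace ℝ (Fin 2), ‖w‖ = 1 ∧ ∀ i, m ≤ ⟪w, x i⟫_ℝ} γ

theorem inner_eq_of_orthonormal_pair {w v : EuclideanSpace ℝ (Fin 2)} (hw : ‖w‖ = 1)
    (hv : ‖v‖ = 1) (hvw : ⟪v, w⟫_ℝ = 0) (a b : EuclideanSpace ℝ (Fin 2)) :
    ⟪a, b⟫_ℝ = ⟪w, a⟫_ℝ * ⟪w, b⟫_ℝ + ⟪a, v⟫_ℝ * ⟪b, v⟫_ℝ := by
  have hon : Orthonormal ℝ ![w, v] := by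
    rw [orthonormal_vecCons_iff]
    refine ⟨hw, fun i => ?_, ?_⟩
    · fin_cases i
      simpa [real_inner_comm] using hvw
    · rw [orthonormal_vecCons_iff]
      exact ⟨hv, fun i => i.elim0, by simp⟩
  let e := basisOfOrthonormalOfCardEqFinrank hon (by simp)
  have he : ⇑e = ![w, v] := coe_basisOfOrthonormalOfCardEqFinrank hon (by simp)
  have h := (e.toOrthonormalBasis (by rw [he]; exact hon)).sum_inner_mul_inner a b
  simp only [Module.Basis.coe_toOrthonormalBasis, he, Fin.sum_univ_two, Matrix.cons_val_zero,
    Matrix.cons_val_one] at h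
  rw [← h, real_inner_comm a w, real_inner_comm v b]

theorem log_one_add_exp_neg_le {a : ℝ} (ha : 0 ≤ a) :
    Real.log (1 + Real.exp (-a)) ≤ 2 * (Real.exp a + 1)⁻¹ := by
  have hpos := Real.exp_pos (-a)
  have h1 : Real.log (1 + Real.exp (-a)) ≤ Real.exp (-a) := by
    linarith [Real.log_le_sub_one_of_pos (show 0 < 1 + Real.exp (-a) by linarith)]
  refine h1.trans ?_
  have h2 : 1 ≤ Real.exp a := Real.one_le_exp ha
  rw [Real.exp_neg, ← div_eq_mul_inv, inv_eq_one_div, div_le_div_iff₀ (by linarith) (by linarith)]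
  linarith

/-- If the step size is at least `n`, a loss above `1 / (8η)` keeps the gradient potential
above `1 / (16η)`. -/
theorem gradPotential_ge_of_loss {n : ℕ} (hn : 0 < n) {x : Fin n → EuclideanSpace ℝ (Fin 2)}
    {η : ℝ} (hη : n ≤ η) {w : EuclideanSpace ℝ (Fin 2)}
    (hF : 1 / (8 * η) < logisticLoss n x w) : 1 / (16 * η) ≤ gradPotential n x w := by
  have hn' : (0 : ℝ) < n := Nat.cast_pos.mpr hn
  have hη0 : 0 < η := hn'.trans_le hη
  have hp : ∀ j, 0 ≤ (Real.exp ⟪w, x j⟫_ℝ + 1)⁻¹ := fun j => by positivity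
  by_cases h : ∀ j, 0 ≤ ⟪w, x j⟫_ℝ
  · have h2 : logisticLoss n x w ≤ 2 * gradPotential n x w := by
      unfold logisticLoss gradPotential
      rw [mul_left_comm, Finset.mul_sum Finset.univ _ (2 : ℝ)]
      gcongr with j
      exact log_one_add_exp_neg_le (h j)
    have h3 : 1 / (8 * η) = 2 * (1 / (16 * η)) := by field_simp; norm_num
    linarith
  · push Not at h
    obtain ⟨j, hj⟩ := h
    have h1 : (1 : ℝ) / 2 ≤ (Real.exp ⟪w, x j⟫_ℝ + 1)⁻¹ := by
      rw [one_div]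
      gcongr
      linarith [Real.exp_le_one_iff.mpr hj.le]
    have h2 := Finset.single_le_sum (fun k _ => hp k) (Finset.mem_univ j)
    have h3 : (n : ℝ)⁻¹ * (1 / 2) ≤ gradPotential n x w := by
      unfold gradPotential
      gcongr
      exact h1.trans h2
    refine le_trans ?_ h3
    calc 1 / (16 * η) ≤ η⁻¹ * (1 / 2) := by field_simp; norm_num
      _ ≤ (n : ℝ)⁻¹ * (1 / 2) := by gcongr

theorem inner_gdIter_succ (n : ℕ) (x : Fin n → EuclideanSpace ℝ (Fin 2)) (η : ℝ) (t : ℕ)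
    (u : EuclideanSpace ℝ (Fin 2)) :
    ⟪gdIter n x η (t + 1), u⟫_ℝ = ⟪gdIter n x η t, u⟫_ℝ
      + η / n * ∑ j, (Real.exp ⟪gdIter n x η t, x j⟫_ℝ + 1)⁻¹ * ⟪x j, u⟫_ℝ := by
  simp only [gdIter, inner_add_left, real_inner_smul_left, sum_inner]

/-- After the first step, the component of the iterates along the separator is at least
`ηγ / 2`. -/
theorem inner_gdIter_separator_ge {n : ℕ} (hn : 0 < n) {x : Fin n → EuclideanSpace ℝ (Fin 2)}
    {γ η : ℝ} (hγ : 0 ≤ γ) (hη : 0 ≤ η) {w : EuclideanSpace ℝ (Fin 2)}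
    (hsep : ∀ i, γ ≤ ⟪w, x i⟫_ℝ) {t : ℕ} (ht : 1 ≤ t) :
    η * γ / 2 ≤ ⟪gdIter n x η t, w⟫_ℝ := by
  have hn' : (0 : ℝ) < n := Nat.cast_pos.mpr hn
  induction t, ht using Nat.le_induction with
  | base =>
    rw [inner_gdIter_succ n x η 0]
    simp only [gdIter, inner_zero_left, Real.exp_zero, zero_add]
    have h : ∑ _j : Fin n, ((1 : ℝ) + 1)⁻¹ * γ ≤ ∑ j, ((1 : ℝ) + 1)⁻¹ * ⟪x j, w⟫_ℝ := by
      gcongr with j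
      rw [real_inner_comm]
      exact hsep j
    rw [Finset.sum_const, Finset.card_univ, Fintype.card_fin, nsmul_eq_mul] at h
    calc η * γ / 2 = η / n * (n * (((1 : ℝ) + 1)⁻¹ * γ)) := by field_simp; norm_num
      _ ≤ _ := by gcongr
  | succ t _ ih =>
    rw [inner_gdIter_succ]
    have h : 0 ≤ ∑ j, (Real.exp ⟪gdIter n x η t, x j⟫_ℝ + 1)⁻¹ * ⟪x j, w⟫_ℝ := by
      refine Finset.sum_nonneg fun j _ => mul_nonneg (by positivity) ?_
      rw [real_inner_comm]
      exact hγ.trans (hsep j)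
    have h2 : 0 ≤ η / n := by positivity
    nlinarith [mul_nonneg h2 h]

theorem exp_neg_le_of_stepSize {γ η : ℝ} (hγ0 : 0 < γ) (hγ1 : γ < 1)
    (hη : 32 / γ ^ 2 * Real.log (256 / γ ^ 2) ≤ η) (hη0 : 0 < η) :
    Real.exp (-(η * γ ^ 2 / 2)) ≤ γ ^ 2 / 2 * (1 / (16 * η)) := by
  have hγ2 : 0 < γ ^ 2 := by positivity
  have hγ2' : γ ^ 2 ≤ 1 := pow_le_one₀ hγ0.le hγ1.le
  have hL : 0 ≤ Real.log (256 / γ ^ 2) := by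
    apply Real.log_nonneg
    rw [le_div_iff₀ hγ2]
    linarith
  have hz : 2 * Real.log (256 / γ ^ 2) ≤ η * γ ^ 2 / 4 := by
    rw [div_mul_eq_mul_div, div_le_iff₀ hγ2] at hη
    linarith
  have h1 : (256 / γ ^ 2) ^ 2 ≤ Real.exp (η * γ ^ 2 / 4) := by
    refine le_trans (le_of_eq ?_) (Real.exp_le_exp.mpr hz)
    rw [two_mul, Real.exp_add, Real.exp_log (by positivity), sq]
  have h2 : η * γ ^ 2 / 4 ≤ Real.exp (η * γ ^ 2 / 4) := by
    linarith [Real.add_one_le_exp (η * γ ^ 2 / 4)]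
  have h3 : (256 / γ ^ 2) ^ 2 * (η * γ ^ 2 / 4) ≤ Real.exp (η * γ ^ 2 / 2) := by
    calc _ ≤ Real.exp (η * γ ^ 2 / 4) * Real.exp (η * γ ^ 2 / 4) := by gcongr
      _ = _ := by rw [← Real.exp_add]; ring_nf
  rw [Real.exp_neg]
  refine (inv_anti₀ (by positivity) h3).trans ?_
  have h4 : ((256 / γ ^ 2) ^ 2 * (η * γ ^ 2 / 4))⁻¹ = γ ^ 2 * (1 / (16384 * η)) := by
    field_simp
    norm_num
  rw [h4]
  have h5 : γ ^ 2 / 2 * (1 / (16 * η)) = 512 * (γ ^ 2 * (1 / (16384 * η))) := by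
    field_simp
    norm_num
  have h6 : 0 ≤ γ ^ 2 * (1 / (16384 * η)) := by positivity
  linarith

theorem stmt_7 (n : ℕ) (hn : 0 < n) (x : Fin n → EuclideanSpace ℝ (Fin 2))
    (hx : ∀ i, ‖x i‖ ≤ 1) (γ : ℝ) (hγ0 : 0 < γ) (hγ1 : γ < 1)
    (hmm : isMaxMargin n x γ)
    (wst : EuclideanSpace ℝ (Fin 2)) (hws : ‖wst‖ = 1) (hsep : ∀ i, γ ≤ ⟪wst, x i⟫_ℝ)
    (vst : EuclideanSpace ℝ (Fin 2)) (hvs : ‖vst‖ = 1) (hvw : ⟪vst, wst⟫_ℝ = 0)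
    (η : ℝ) (hη : max (n : ℝ) (32 / γ ^ 2 * Real.log (256 / γ ^ 2)) ≤ η)
    (t : ℕ) (ht : 1 ≤ t)
    (hloss : ∀ s : ℕ, s ≤ t → 1 / (8 * η) < logisticLoss n x (gdIter n x η s)) :
    ∀ i : Fin n, ⟪x i, vst⟫_ℝ * ⟪gdIter n x η t, vst⟫_ℝ < 0 →
      max (η * ‖x i‖ ^ 2 / (2 * n * (Real.exp ⟪gdIter n x η t, x i⟫_ℝ + 1)))
          (1 / 2 * (η * γ ^ 2 * gradPotential n x (gdIter n x η t)))
        ≤ ⟪gdIter n x η (t + 1), x i⟫_ℝ - ⟪gdIter n x η t, x i⟫_ℝ := by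
  intro i hi
  have hn' : (0 : ℝ) < n := Nat.cast_pos.mpr hn
  have hηn : (n : ℝ) ≤ η := (le_max_left _ _).trans hη
  have hη0 : 0 < η := hn'.trans_le hηn
  have hG := gradPotential_ge_of_loss hn hηn (hloss t le_rfl)
  have hw := inner_gdIter_separator_ge hn hγ0.le hη0.le hsep ht
  have hε := exp_neg_le_of_stepSize hγ0 hγ1 ((le_max_right _ _).trans hη) hη0
  rw [inner_gdIter_succ, add_sub_cancel_left]
  unfold gradPotential at *
  set w := gdIter n x η t
  set p : Fin n → ℝ := fun j => (Real.exp ⟪w, x j⟫_ℝ + 1)⁻¹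
  have hp : ∀ j, 0 < p j := fun j => by positivity
  change max _ (1 / 2 * (η * γ ^ 2 * ((n : ℝ)⁻¹ * ∑ j, p j))) ≤ η / n * ∑ j, p j * ⟪x j, x i⟫_ℝ
  change 1 / (16 * η) ≤ (n : ℝ)⁻¹ * ∑ j, p j at hG
  set ε := Real.exp (-(η * γ ^ 2 / 2))
  have hlow : ∀ j, γ ^ 2 * p j - ε ≤ p j * ⟪x j, x i⟫_ℝ := by
    intro j
    have hu : γ ^ 2 ≤ ⟪wst, x j⟫_ℝ * ⟪wst, x i⟫_ℝ := by
      nlinarith [hsep j, hsep i]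
    rw [inner_eq_of_orthonormal_pair hws hvs hvw (x j) (x i)]
    rcases le_or_gt 0 (⟪x j, vst⟫_ℝ * ⟪x i, vst⟫_ℝ) with h | h
    · have : 0 < ε := Real.exp_pos _
      nlinarith [hp j]
    · have hjw : 0 ≤ ⟪w, vst⟫_ℝ * ⟪x j, vst⟫_ℝ := by
        by_contra! hneg
        have := mul_pos_of_neg_of_neg h hi
        have h4 := mul_pos_of_neg_of_neg hneg (show -⟪x i, vst⟫_ℝ ^ 2 < 0 by
          have : ⟪x i, vst⟫_ℝ ≠ 0 := by rintro h0; simp [h0] at h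
          have : 0 < ⟪x i, vst⟫_ℝ ^ 2 := by positivity
          linarith)
        nlinarith
      have ha : η * γ ^ 2 / 2 ≤ ⟪w, x j⟫_ℝ := by
        rw [inner_eq_of_orthonormal_pair hws hvs hvw w (x j), real_inner_comm w wst]
        have : η * γ / 2 * γ ≤ ⟪w, wst⟫_ℝ * ⟪wst, x j⟫_ℝ :=
          mul_le_mul hw (hsep j) hγ0.le ((by positivity : 0 ≤ η * γ / 2).trans hw)
        nlinarith
      have hpj : p j ≤ ε := by
        simp only [p, ε, Real.exp_neg]
        exact inv_anti₀ (Real.exp_pos _) (by linarith [Real.exp_le_exp.mpr ha])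
      have habs : ∀ k, |⟪x k, vst⟫_ℝ| ≤ 1 := fun k => by
        have := abs_real_inner_le_norm (x k) vst
        rw [hvs, mul_one] at this
        exact this.trans (hx k)
      have hge : -1 ≤ ⟪x j, vst⟫_ℝ * ⟪x i, vst⟫_ℝ := by
        refine (abs_le.mp ?_).1
        rw [abs_mul]
        exact mul_le_one₀ (habs j) (abs_nonneg _) (habs i)
      nlinarith [hp j]
  have hsum : n * ε ≤ γ ^ 2 / 2 * ∑ j, p j := by
    have h := hε.trans (mul_le_mul_of_nonneg_left hG (by positivity : 0 ≤ γ ^ 2 / 2))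
    calc n * ε ≤ n * (γ ^ 2 / 2 * ((n : ℝ)⁻¹ * ∑ j, p j)) := by gcongr
      _ = _ := by field_simp
  have hself : γ ^ 2 ≤ ‖x i‖ ^ 2 := by
    have h := (hsep i).trans (real_inner_le_norm wst (x i))
    rw [hws, one_mul] at h
    gcongr
  have hall : ∑ j, (γ ^ 2 * p j - ε) = γ ^ 2 * ∑ j, p j - n * ε := by
    rw [Finset.sum_sub_distrib, ← Finset.mul_sum]
    simp
  have hrest : ∑ j, (γ ^ 2 * p j - ε) + (‖x i‖ ^ 2 - γ ^ 2) * p i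
      ≤ ∑ j, p j * ⟪x j, x i⟫_ℝ := by
    rw [← Finset.add_sum_erase _ _ (Finset.mem_univ i),
      ← Finset.add_sum_erase _ (fun j => p j * ⟪x j, x i⟫_ℝ) (Finset.mem_univ i),
      real_inner_self_eq_norm_sq]
    have := Finset.sum_le_sum fun j (_ : j ∈ Finset.univ.erase i) => hlow j
    have : 0 < ε := Real.exp_pos _
    linarith
  have hpi : p i ≤ ∑ j, p j :=
    Finset.single_le_sum (fun k _ => (hp k).le) (Finset.mem_univ i)
  have hext : 0 ≤ (‖x i‖ ^ 2 - γ ^ 2) * p i := mul_nonneg (by linarith) (hp i).le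
  rw [hall] at hrest
  refine max_le ?_ ?_
  · calc η * ‖x i‖ ^ 2 / (2 * n * (Real.exp ⟪w, x i⟫_ℝ + 1))
        = η / n * (‖x i‖ ^ 2 * p i / 2) := by simp only [p]; field_simp
      _ ≤ _ := by
        gcongr
        nlinarith [mul_le_mul_of_nonneg_left hpi (sq_nonneg γ)]
  · calc 1 / 2 * (η * γ ^ 2 * ((n : ℝ)⁻¹ * ∑ j, p j))
        = η / n * (γ ^ 2 / 2 * ∑ j, p j) := by ring
      _ ≤ _ := by
        gcongr
        linarith
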